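/- arXiv:1604.03000 — 2 statements merged into one kernel-verified Lean document; each statement's English description precedes it below -/
import Mathlib

section
/- Let n ≥ 1 and t ≥ k ≥ 1 be integers, let X ∈ 𝔽_q^{n+t−k−1} and Y ∈ 𝔽_q^{n−1} be sequences, and let a ∈ 𝔽_q. Then |I_k(aX) ∩ I_t(aY)| = |I_k(X) ∩ I_t(Y)| + (q−1)·|I_{k−1}(aX) ∩ I_{t−1}(aY)|, where aX denotes the sequence a prepended to X. -/
open scoped BigOperators

/-- The insertion ball `I_t(X)`: supersequences of `X` of length `X.length + t`. -/
def insBall (q t : ℕ) (X : List (Fin q)) : Set (List (Fin q)) :=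
  {W | W.length = X.length + t ∧ X.Sublist W}

theorem insBall_finite (q t : ℕ) (X : List (Fin q)) : (insBall q t X).Finite :=
  (List.finite_length_eq (Fin q) (X.length + t)).subset fun _ hW => hW.1

theorem nil_notMem_insBall_cons (q t : ℕ) (a : Fin q) (X : List (Fin q)) :
    [] ∉ insBall q t (a :: X) := by
  simp [insBall]

theorem cons_mem_insBall_cons_self (q t : ℕ) (a : Fin q) (X V : List (Fin q)) :
    a :: V ∈ insBall q t (a :: X) ↔ V ∈ insBall q t X := by
  simp only [insBall, Set.mem_ofPred_eq, List.length_cons, List.cons_sublist_cons]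
  exact and_congr_left fun _ => by omega

theorem cons_mem_insBall_cons_of_ne {q t : ℕ} (ht : 1 ≤ t) {a b : Fin q} (hb : b ≠ a)
    (X V : List (Fin q)) :
    b :: V ∈ insBall q t (a :: X) ↔ V ∈ insBall q (t - 1) (a :: X) := by
  simp only [insBall, Set.mem_ofPred_eq, List.length_cons, List.sublist_cons_iff]
  refine and_congr (by omega) (or_iff_left ?_)
  rintro ⟨r, hr, -⟩
  exact hb (List.cons.inj hr).1.symm

theorem insBall_cons_inter_insBall_cons {q t k : ℕ} (hk : 1 ≤ k) (ht : 1 ≤ t) (a : Fin q)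
    (X Y : List (Fin q)) :
    insBall q k (a :: X) ∩ insBall q t (a :: Y) =
      List.cons a '' (insBall q k X ∩ insBall q t Y) ∪
        (fun p : Fin q × List (Fin q) => p.1 :: p.2) '' ({a}ᶜ ×ˢ
          (insBall q (k - 1) (a :: X) ∩ insBall q (t - 1) (a :: Y))) := by
  ext W
  cases W with
  | nil => simp [nil_notMem_insBall_cons]
  | cons b V =>
    by_cases hb : b = a
    · subst hb
      simp [cons_mem_insBall_cons_self]
    · simp [cons_mem_insBall_cons_of_ne hk hb, cons_mem_insBall_cons_of_ne ht hb, hb,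
        Ne.symm hb]

theorem intersection_recursion_same_first_symbol (q n t k : ℕ) (hn : 1 ≤ n)
    (hkt : k ≤ t) (hk : 1 ≤ k)
    (a : Fin q) (X Y : List (Fin q))
    (hX : X.length = n + t - k - 1) (hY : Y.length = n - 1) :
    (insBall q k (a :: X) ∩ insBall q t (a :: Y)).ncard =
      (insBall q k X ∩ insBall q t Y).ncard +
        (q - 1) * (insBall q (k - 1) (a :: X) ∩ insBall q (t - 1) (a :: Y)).ncard := by
  have hinj : Function.Injective (fun p : Fin q × List (Fin q) => p.1 :: p.2) :=
    fun _ _ h => Prod.ext (List.cons.inj h).1 (List.cons.inj h).2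
  have hcompl : ({a}ᶜ : Set (Fin q)).ncard = q - 1 := by
    rw [Set.ncard_compl, Set.ncard_singleton, Nat.card_fin]
  have hfin := ((insBall_finite q k X).inter_of_left (insBall q t Y)).image (List.cons a)
  have hfin' := ((Set.toFinite {a}ᶜ).prod ((insBall_finite q (k - 1) (a :: X)).inter_of_left
    (insBall q (t - 1) (a :: Y)))).image (fun p : Fin q × List (Fin q) => p.1 :: p.2)
  rw [insBall_cons_inter_insBall_cons hk (hk.trans hkt),
    Set.ncard_union_eq ?_ hfin hfin',
    Set.ncard_image_of_injective _ List.cons_injective, Set.ncard_image_of_injective _ hinj,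
    Set.ncard_prod, hcompl]
  rw [Set.disjoint_left]
  rintro _ ⟨V, -, rfl⟩ ⟨p, hp, h⟩
  exact hp.1 (List.cons.inj h).1
end

section
/- Let n ≥ 4 and t ≥ 2 be integers and let V ∈ 𝔽_2^{n−2} be any binary sequence, and set p = ⌊n/2⌋. Define X = (v₁,…,v_{p−1}, 1, 1, v_p,…,v_{n−2}), Z = (v₁,…,v_{p−1}, 0, 0, v_p,…,v_{n−2}), Y = (v₁,…,v_{p−1}, 0, v_p, 0, v_{p+1},…,v_{n−2}), and W = (v₁,…,v_{p−1}, 1, v_p, 1, v_{p+1},…,v_{n−2}), all of length n. Then |I_t(X) ∩ I_t(Z)| = N⁺_2(n,t,2) and |I_t(Y) ∩ I_t(W)| = N⁺_2(n,t,2). -/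
open scoped BigOperators

/-- Length of a longest common subsequence of `X` and `Y`. -/
noncomputable def lcsLen {q : ℕ} (X Y : List (Fin q)) : ℕ :=
  sSup {m | ∃ Z : List (Fin q), Z.Sublist X ∧ Z.Sublist Y ∧ Z.length = m}

/-- The edit distance `d_e(X,Y) = |X| + |Y| - 2L`. -/
noncomputable def editDist {q : ℕ} (X Y : List (Fin q)) : ℕ :=
  X.length + Y.length - 2 * lcsLen X Y

/-- `N⁺_q(n,t,ℓ)`: the maximum of `|I_t(X) ∩ I_t(Y)|` over pairs `X, Y ∈ 𝔽_q^n`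
with `d_e(X,Y) ≥ 2ℓ`. -/
noncomputable def NplusEq (q n t ℓ : ℕ) : ℕ :=
  sSup {c | ∃ X Y : List (Fin q), X.length = n ∧ Y.length = n ∧
    2 * ℓ ≤ editDist X Y ∧ c = (insBall q t X ∩ insBall q t Y).ncard}

/-- The words of length `m` containing both `X` and `Y` as subsequences. -/
def commonSuper (X Y : List (Fin 2)) (m : ℕ) : Set (List (Fin 2)) :=
  {W | W.length = m ∧ X.Sublist W ∧ Y.Sublist W}

/-- What remains to be embedded of a word after the letter `a` has been read. -/
def residualWord (a : Fin 2) : List (Fin 2) → List (Fin 2)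
  | [] => []
  | b :: X => if a = b then X else b :: X

theorem sublist_cons_iff_residualWord (a : Fin 2) (X W : List (Fin 2)) :
    X.Sublist (a :: W) ↔ (residualWord a X).Sublist W := by
  cases X with
  | nil => simp [residualWord]
  | cons b X =>
    by_cases h : a = b
    · subst h
      simp [residualWord]
    · simp only [residualWord, if_neg h]
      rw [List.sublist_cons_iff]
      refine ⟨?_, Or.inl⟩
      rintro (h1 | ⟨r, hr, -⟩)
      · exact h1
      · simp only [List.cons.injEq] at hr
        exact absurd hr.1.symm h

theorem commonSuper_finite (X Y : List (Fin 2)) (m : ℕ) : (commonSuper X Y m).Finite :=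
  (List.finite_length_eq (Fin 2) m).subset fun _ h => h.1

theorem commonSuper_succ (X Y : List (Fin 2)) (m : ℕ) :
    commonSuper X Y (m + 1) =
      List.cons 0 '' commonSuper (residualWord 0 X) (residualWord 0 Y) m ∪
        List.cons 1 '' commonSuper (residualWord 1 X) (residualWord 1 Y) m := by
  ext W
  cases W with
  | nil => simp [commonSuper]
  | cons a W =>
    fin_cases a <;> simp [commonSuper, sublist_cons_iff_residualWord]

theorem ncard_commonSuper_succ (X Y : List (Fin 2)) (m : ℕ) :
    (commonSuper X Y (m + 1)).ncard =
      (commonSuper (residualWord 0 X) (residualWord 0 Y) m).ncard +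
        (commonSuper (residualWord 1 X) (residualWord 1 Y) m).ncard := by
  rw [commonSuper_succ, Set.ncard_union_eq _ ((commonSuper_finite _ _ _).image _)
    ((commonSuper_finite _ _ _).image _), Set.ncard_image_of_injective _ List.cons_injective,
    Set.ncard_image_of_injective _ List.cons_injective]
  rw [Set.disjoint_left]
  rintro _ ⟨U, -, rfl⟩ ⟨U', -, h⟩
  simp at h

theorem ncard_commonSuper_cons_self (a : Fin 2) (X Y : List (Fin 2)) (m : ℕ) :
    (commonSuper (a :: X) (a :: Y) (m + 1)).ncard =
      (commonSuper X Y m).ncard + (commonSuper (a :: X) (a :: Y) m).ncard := by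
  rw [ncard_commonSuper_succ]
  fin_cases a <;> simp [residualWord, add_comm]

theorem ncard_commonSuper_cons_of_ne {a b : Fin 2} (hab : a ≠ b) (X Y : List (Fin 2)) (m : ℕ) :
    (commonSuper (a :: X) (b :: Y) (m + 1)).ncard =
      (commonSuper X (b :: Y) m).ncard + (commonSuper (a :: X) Y m).ncard := by
  rw [ncard_commonSuper_succ]
  fin_cases a <;> fin_cases b <;> simp_all [residualWord, add_comm]

theorem ncard_commonSuper_cons_zero (a : Fin 2) (X Y : List (Fin 2)) :
    (commonSuper (a :: X) Y 0).ncard = 0 := by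
  have : commonSuper (a :: X) Y 0 = ∅ := by
    ext W
    cases W <;> simp [commonSuper]
  simp [this]

theorem commonSuper_comm (X Y : List (Fin 2)) (m : ℕ) :
    commonSuper X Y m = commonSuper Y X m := by
  ext W
  simp only [commonSuper, Set.mem_ofPred_eq]
  tauto

theorem commonSuper_of_sublist {X Y : List (Fin 2)} (h : X.Sublist Y) (m : ℕ) :
    commonSuper X Y m = commonSuper [] Y m := by
  ext W
  simp only [commonSuper, Set.mem_ofPred_eq, List.nil_sublist, true_and]
  exact ⟨fun hW => ⟨hW.1, hW.2.2⟩, fun hW => ⟨hW.1, h.trans hW.2, hW.2⟩⟩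

/-- The number of binary words of length `m` containing a fixed word of length `k`. -/
def superCount : ℕ → ℕ → ℕ
  | 0, 0 => 1
  | _ + 1, 0 => 0
  | 0, m + 1 => 2 * superCount 0 m
  | k + 1, m + 1 => superCount k m + superCount (k + 1) m

theorem ncard_commonSuper_nil (Y : List (Fin 2)) (m : ℕ) :
    (commonSuper [] Y m).ncard = superCount Y.length m := by
  induction m generalizing Y with
  | zero =>
    cases Y with
    | nil =>
      have : commonSuper [] [] 0 = {[]} := by
        ext W
        simp [commonSuper]
      simp [this, superCount]
    | cons b Y =>
      rw [commonSuper_comm, ncard_commonSuper_cons_zero]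
      simp [superCount]
  | succ m ih =>
    rw [ncard_commonSuper_succ]
    cases Y with
    | nil => simp [residualWord, ih, superCount, two_mul]
    | cons b Y =>
      rw [List.length_cons, superCount]
      fin_cases b <;> simp [residualWord, ih, add_comm]

/-- The maximal number of common supersequences of length `m` of two binary words of lengths
`c + i` and `c + j` all of whose common subsequences have length at most `c`. -/
def maxCommonCount : ℕ → ℕ → ℕ → ℕ → ℕ
  | 0, j, c, m => superCount (c + j) m
  | i + 1, 0, c, m => superCount (c + (i + 1)) m
  | _ + 1, _ + 1, _, 0 => 0
  | i + 1, j + 1, c, m + 1 => maxCommonCount i (j + 1) c m + maxCommonCount (i + 1) j c m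

theorem maxCommonCount_zero_right (i c m : ℕ) :
    maxCommonCount i 0 c m = superCount (c + i) m := by
  cases i <;> simp [maxCommonCount]

theorem maxCommonCount_succ_zero (i j c : ℕ) : maxCommonCount i j (c + 1) 0 = 0 := by
  have h (k : ℕ) : superCount (c + 1 + k) 0 = 0 := by
    rw [Nat.add_right_comm, superCount]
  cases i <;> cases j <;> simp only [maxCommonCount, h]

theorem maxCommonCount_pascal (i j c m : ℕ) :
    maxCommonCount i j (c + 1) (m + 1) =
      maxCommonCount i j c m + maxCommonCount i j (c + 1) m := by
  have h (k m : ℕ) : superCount (c + 1 + k) (m + 1) =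
      superCount (c + k) m + superCount (c + 1 + k) m := by
    rw [Nat.add_right_comm, superCount]
  induction m generalizing i j with
  | zero =>
    cases i with
    | zero => simp only [maxCommonCount, h]
    | succ i =>
      cases j with
      | zero => simp only [maxCommonCount, h]
      | succ j => simp [maxCommonCount, maxCommonCount_succ_zero]
  | succ m ih =>
    cases i with
    | zero => simp only [maxCommonCount, h]
    | succ i =>
      cases j with
      | zero => simp only [maxCommonCount, h]
      | succ j =>
        rw [maxCommonCount, ih, ih, maxCommonCount, maxCommonCount]
        omega

theorem ncard_commonSuper_le_right (X Y : List (Fin 2)) (m : ℕ) :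
    (commonSuper X Y m).ncard ≤ superCount Y.length m := by
  rw [← ncard_commonSuper_nil]
  exact Set.ncard_le_ncard (fun W hW => ⟨hW.1, List.nil_sublist _, hW.2.2⟩)
    (commonSuper_finite _ _ _)

theorem ncard_commonSuper_le_left (X Y : List (Fin 2)) (m : ℕ) :
    (commonSuper X Y m).ncard ≤ superCount X.length m := by
  rw [commonSuper_comm]
  exact ncard_commonSuper_le_right Y X m

theorem ncard_commonSuper_le_maxCommonCount (i j c m : ℕ) (X Y : List (Fin 2))
    (hX : X.length = c + i) (hY : Y.length = c + j)
    (h : ∀ U : List (Fin 2), U.Sublist X → U.Sublist Y → U.length ≤ c) :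
    (commonSuper X Y m).ncard ≤ maxCommonCount i j c m := by
  induction m generalizing i j c X Y with
  | zero =>
    cases i with
    | zero =>
      rw [maxCommonCount, ← hY]
      exact ncard_commonSuper_le_right X Y _
    | succ i =>
      cases X with
      | nil => simp at hX
      | cons a X => simp [ncard_commonSuper_cons_zero]
  | succ m ih =>
    cases i with
    | zero =>
      rw [maxCommonCount, ← hY]
      exact ncard_commonSuper_le_right X Y _
    | succ i =>
    cases j with
    | zero =>
      rw [maxCommonCount, ← hX]
      exact ncard_commonSuper_le_left X Y _
    | succ j =>
    cases X with
    | nil => simp at hX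
    | cons a X =>
    cases Y with
    | nil => simp at hY
    | cons b Y =>
    simp only [List.length_cons] at hX hY
    by_cases hab : a = b
    · subst hab
      cases c with
      | zero => simpa using h [a] (by simp) (by simp)
      | succ c =>
        rw [ncard_commonSuper_cons_self, maxCommonCount_pascal]
        refine Nat.add_le_add (ih _ _ _ _ _ (by omega) (by omega) fun U hU hU' => ?_)
          (ih _ _ _ _ _ (by simpa using hX) (by simpa using hY) h)
        simpa using h (a :: U) (hU.cons_cons a) (hU'.cons_cons a)
    · rw [ncard_commonSuper_cons_of_ne hab, maxCommonCount]
      exact Nat.add_le_add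
        (ih _ _ _ _ _ (by omega) (by simpa using hY) fun U hU hU' => h U (hU.cons a) hU')
        (ih _ _ _ _ _ (by simpa using hX) (by omega) fun U hU hU' => h U hU (hU'.cons b))

/-- The pair `X`, `Y` attains the maximal number of common supersequences of every length. -/
def IsExtremal (i j c : ℕ) (X Y : List (Fin 2)) : Prop :=
  ∀ m, (commonSuper X Y m).ncard = maxCommonCount i j c m

namespace IsExtremal

theorem of_sublist_left {j c : ℕ} {X Y : List (Fin 2)} (h : X.Sublist Y)
    (hY : Y.length = c + j) : IsExtremal 0 j c X Y := fun m => by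
  rw [commonSuper_of_sublist h, ncard_commonSuper_nil, hY, maxCommonCount]

theorem of_sublist_right {i c : ℕ} {X Y : List (Fin 2)} (h : Y.Sublist X)
    (hX : X.length = c + i) : IsExtremal i 0 c X Y := fun m => by
  rw [commonSuper_comm, commonSuper_of_sublist h, ncard_commonSuper_nil, hX,
    maxCommonCount_zero_right]

theorem cons_self {i j c : ℕ} {X Y : List (Fin 2)} (h : IsExtremal i j c X Y) (a : Fin 2) :
    IsExtremal i j (c + 1) (a :: X) (a :: Y) := fun m => by
  induction m with
  | zero => rw [ncard_commonSuper_cons_zero, maxCommonCount_succ_zero]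
  | succ m ih => rw [ncard_commonSuper_cons_self, maxCommonCount_pascal, h m, ih]

theorem cons_of_ne {i j c : ℕ} {a b : Fin 2} {X Y : List (Fin 2)} (hab : a ≠ b)
    (h : IsExtremal i (j + 1) c X (b :: Y)) (h' : IsExtremal (i + 1) j c (a :: X) Y) :
    IsExtremal (i + 1) (j + 1) c (a :: X) (b :: Y) := fun m => by
  cases m with
  | zero => rw [ncard_commonSuper_cons_zero, maxCommonCount]
  | succ m => rw [ncard_commonSuper_cons_of_ne hab, maxCommonCount, h m, h' m]

theorem append_left {i j c : ℕ} {X Y : List (Fin 2)} (h : IsExtremal i j c X Y)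
    (P : List (Fin 2)) : IsExtremal i j (P.length + c) (P ++ X) (P ++ Y) := by
  induction P with
  | nil => simpa using h
  | cons a P ih =>
    have := ih.cons_self a
    rwa [Nat.add_right_comm] at this

theorem one_one {a b : Fin 2} (hab : a ≠ b) (U : List (Fin 2)) :
    IsExtremal 1 1 U.length (a :: U) (b :: U) :=
  cons_of_ne hab (of_sublist_left (by simp) (by simp)) (of_sublist_right (by simp) (by simp))

theorem one_two {a b : Fin 2} (hab : a ≠ b) (U : List (Fin 2)) :
    IsExtremal 1 2 U.length (a :: U) (b :: b :: U) :=
  cons_of_ne hab (of_sublist_left ((List.sublist_cons_self _ _).cons _) (by simp))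
    (one_one hab U)

theorem two_one {a b : Fin 2} (hab : a ≠ b) (U : List (Fin 2)) :
    IsExtremal 2 1 U.length (a :: a :: U) (b :: U) :=
  cons_of_ne hab (one_one hab U)
    (of_sublist_right ((List.sublist_cons_self _ _).cons _) (by simp))

theorem two_two {a b : Fin 2} (hab : a ≠ b) (U : List (Fin 2)) :
    IsExtremal 2 2 U.length (a :: a :: U) (b :: b :: U) :=
  cons_of_ne hab (one_two hab U) (two_one hab U)

theorem two_two_interleaved (v : Fin 2) (U : List (Fin 2)) :
    IsExtremal 2 2 (U.length + 1) (0 :: v :: 0 :: U) (1 :: v :: 1 :: U) := by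
  have h01 : (0 : Fin 2) ≠ 1 := by decide
  refine cons_of_ne h01 ?_ ?_
  · obtain rfl | rfl : v = 0 ∨ v = 1 := by omega
    · exact cons_of_ne h01 (of_sublist_left (by simp) (by simp)) ((one_one h01 U).cons_self 0)
    · exact (one_two h01 U).cons_self 1
  · obtain rfl | rfl : v = 0 ∨ v = 1 := by omega
    · exact (two_one h01 U).cons_self 0
    · exact cons_of_ne h01 ((one_one h01 U).cons_self 1)
        (of_sublist_right (by simp) (by simp))

end IsExtremal

theorem insBall_inter_insBall {n t : ℕ} {X Y : List (Fin 2)} (hX : X.length = n)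
    (hY : Y.length = n) : insBall 2 t X ∩ insBall 2 t Y = commonSuper X Y (n + t) := by
  ext W
  simp only [insBall, commonSuper, hX, hY, Set.mem_inter_iff, Set.mem_ofPred_eq]
  tauto

theorem length_le_lcsLen {q : ℕ} {X Y U : List (Fin q)} (hX : U.Sublist X) (hY : U.Sublist Y) :
    U.length ≤ lcsLen X Y :=
  le_csSup ⟨X.length, by rintro _ ⟨Z, hZ, -, rfl⟩; exact hZ.length_le⟩ ⟨U, hX, hY, rfl⟩

theorem lcsLen_le {q c : ℕ} {X Y : List (Fin q)}
    (h : ∀ U : List (Fin q), U.Sublist X → U.Sublist Y → U.length ≤ c) : lcsLen X Y ≤ c :=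
  csSup_le ⟨0, [], by simp⟩ (by rintro _ ⟨Z, hX, hY, rfl⟩; exact h Z hX hY)

theorem length_eq_count_zero_add_count_one (U : List (Fin 2)) :
    U.length = U.count 0 + U.count 1 := by
  induction U with
  | nil => rfl
  | cons a U ih => fin_cases a <;> simp [ih] <;> omega

theorem lcsLen_le_count (X Y : List (Fin 2)) : lcsLen X Y ≤ X.count 0 + Y.count 1 :=
  lcsLen_le fun U hX hY => by
    rw [length_eq_count_zero_add_count_one]
    exact Nat.add_le_add (hX.count_le 0) (hY.count_le 1)

theorem lcsLen_comm {q : ℕ} (X Y : List (Fin q)) : lcsLen X Y = lcsLen Y X :=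
  le_antisymm (lcsLen_le fun _ hX hY => length_le_lcsLen hY hX)
    (lcsLen_le fun _ hY hX => length_le_lcsLen hX hY)

theorem IsExtremal.ncard_eq_NplusEq {c t : ℕ} {X Y : List (Fin 2)} {l : ℕ}
    (h : IsExtremal l l c X Y) (hX : X.length = c + l) (hY : Y.length = c + l)
    (hlcs : lcsLen X Y ≤ c) :
    (insBall 2 t X ∩ insBall 2 t Y).ncard = NplusEq 2 (c + l) t l := by
  have hmax : IsGreatest {k | ∃ X Y : List (Fin 2), X.length = c + l ∧ Y.length = c + l ∧
      2 * l ≤ editDist X Y ∧ k = (insBall 2 t X ∩ insBall 2 t Y).ncard}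
      (insBall 2 t X ∩ insBall 2 t Y).ncard := by
    refine ⟨⟨X, Y, hX, hY, by unfold editDist; omega, rfl⟩, ?_⟩
    rintro _ ⟨X', Y', hX', hY', hd, rfl⟩
    rw [insBall_inter_insBall hX hY, insBall_inter_insBall hX' hY', h]
    refine ncard_commonSuper_le_maxCommonCount _ _ _ _ _ _ hX' hY' fun U hU hU' => ?_
    have := length_le_lcsLen hU hU'
    have := hU.length_le
    unfold editDist at hd
    omega
  exact hmax.csSup_eq.symm

theorem vt_extremal_pairs (n t : ℕ) (hn : 4 ≤ n) (ht : 2 ≤ t)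
    (V : List (Fin 2)) (hV : V.length = n - 2) :
    let p : ℕ := n / 2
    let X : List (Fin 2) := V.take (p - 1) ++ [1, 1] ++ V.drop (p - 1)
    let Z : List (Fin 2) := V.take (p - 1) ++ [0, 0] ++ V.drop (p - 1)
    let Y : List (Fin 2) :=
      V.take (p - 1) ++ [0] ++ (V.drop (p - 1)).take 1 ++ [0] ++ V.drop p
    let W : List (Fin 2) :=
      V.take (p - 1) ++ [1] ++ (V.drop (p - 1)).take 1 ++ [1] ++ V.drop p
    (insBall 2 t X ∩ insBall 2 t Z).ncard = NplusEq 2 n t 2 ∧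
      (insBall 2 t Y ∩ insBall 2 t W).ncard = NplusEq 2 n t 2 := by
  intro p X Z Y W
  have hp : p - 1 < V.length := by omega
  have hp1 : p - 1 + 1 = p := by omega
  obtain ⟨P, v, U, rfl, hP⟩ : ∃ P v U, V = P ++ v :: U ∧ P.length = p - 1 :=
    ⟨V.take (p - 1), V[p - 1], V.drop (p - 1 + 1), by simp, by simp; omega⟩
  have htake : (P ++ v :: U).take (p - 1) = P := by rw [← hP, List.take_left]
  have hdrop : (P ++ v :: U).drop (p - 1) = v :: U := by rw [← hP, List.drop_left]
  have hdrop' : (P ++ v :: U).drop p = U := by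
    rw [← hp1, ← hP]
    simp [List.drop_append]
  have hX : X = P ++ 1 :: 1 :: v :: U := by simp [X, htake, hdrop]
  have hZ : Z = P ++ 0 :: 0 :: v :: U := by simp [Z, htake, hdrop]
  have hY : Y = P ++ 0 :: v :: 0 :: U := by simp [Y, htake, hdrop, hdrop']
  have hW : W = P ++ 1 :: v :: 1 :: U := by simp [W, htake, hdrop, hdrop']
  have hn' : n = P.length + (U.length + 1) + 2 := by simp at hV; omega
  have hcount := length_eq_count_zero_add_count_one (P ++ v :: U)
  simp [List.count_cons] at hcount
  rw [hX, hZ, hY, hW, hn']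
  refine ⟨((IsExtremal.two_two (by decide) (v :: U)).append_left P).ncard_eq_NplusEq
    (by simp; omega) (by simp; omega) ((lcsLen_le_count _ _).trans ?_),
    ((IsExtremal.two_two_interleaved v U).append_left P).ncard_eq_NplusEq
    (by simp; omega) (by simp; omega) ?_⟩
  · simp [List.count_cons]
    omega
  · rw [lcsLen_comm]
    refine (lcsLen_le_count _ _).trans ?_
    simp [List.count_cons]
    omega
end
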